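/- Let r ≥ 4 and n ≥ 1 be integers, and let G be an r-graph on n vertices that contains no (8r−14, 8)-configuration and, for every ℓ with 2 ≤ ℓ ≤ 7, no (rℓ−2ℓ+1, ℓ)-configuration. Then the number of edges of G is at most C(n,2)/C(r,2); equivalently, r(r−1)·|E(G)| ≤ n(n−1). -/

import Mathlib

/-- An `(s,k)`-configuration in `G`: `k` distinct edges whose union has at most `s` vertices. -/
def HasConfig {n : ℕ} (G : Finset (Finset (Fin n))) (s k : ℕ) : Prop :=
  ∃ S ⊆ G, S.card = k ∧ (S.sup id).card ≤ s

namespace BES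
open Finset

variable {α : Type*} [DecidableEq α]

/-- Vertex set spanned by a set of edges. -/
abbrev V (S : Finset (Finset α)) : Finset α := S.sup id

structure Good (s : ℕ) (G : Finset (Finset α)) : Prop where
  two : 2 ≤ s
  unif : ∀ e ∈ G, e.card = s + 2
  low7 : ∀ S ⊆ G, S.Nonempty → S.card ≤ 7 → s * S.card + 2 ≤ (V S).card
  low8 : ∀ S ⊆ G, S.card = 8 → s * 8 + 3 ≤ (V S).card

/-- Dense sets of edges. -/
def Dn (s : ℕ) (G S : Finset (Finset α)) : Prop := S ⊆ G ∧ (V S).card ≤ s * S.card + 2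

theorem V_union (S T : Finset (Finset α)) : V (S ∪ T) = V S ∪ V T := by
  simp [V, sup_union]

theorem V_mono {S T : Finset (Finset α)} (h : S ⊆ T) : V S ⊆ V T := sup_mono h

theorem sub_V {S : Finset (Finset α)} {e : Finset α} (h : e ∈ S) : e ⊆ V S :=
  le_sup (f := id) h

theorem V_single (e : Finset α) : V {e} = e := by simp [V]

variable {s : ℕ} {G : Finset (Finset α)}

theorem Good.low (H : Good s G) {S : Finset (Finset α)} (hS : S ⊆ G) (hn : S.Nonempty)
    (hc : S.card ≤ 8) : s * S.card + 2 ≤ (V S).card := by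
  rcases Nat.lt_or_ge S.card 8 with h | h
  · exact H.low7 S hS hn (by omega)
  · have h8 : S.card = 8 := by omega
    have := H.low8 S hS h8
    rw [h8]; omega

theorem Good.ne8 (H : Good s G) {S : Finset (Finset α)} (hS : Dn s G S) : S.card ≠ 8 := by
  intro h
  have := H.low8 S hS.1 h
  have h2 := hS.2
  rw [h] at h2; omega

theorem Good.single (H : Good s G) {e : Finset α} (he : e ∈ G) : Dn s G {e} := by
  refine ⟨by simpa using he, ?_⟩
  rw [V_single, H.unif e he]; simp

theorem Good.lemU (H : Good s G) {S T : Finset (Finset α)} (hS : Dn s G S) (hT : Dn s G T)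
    (hI : (S ∩ T).Nonempty) (hc : (S ∪ T).card ≤ 8) :
    (V (S ∩ T)).card ≤ s * (S ∩ T).card + 2 ∧ V S ∩ V T = V (S ∩ T) := by
  have h1 : s * (S ∪ T).card + 2 ≤ (V (S ∪ T)).card :=
    H.low (union_subset hS.1 hT.1) (hI.mono (inter_subset_left.trans subset_union_left)) hc
  rw [V_union] at h1
  have h2 := card_union_add_card_inter (V S) (V T)
  have h3 := card_union_add_card_inter S T
  have hsub : V (S ∩ T) ⊆ V S ∩ V T :=
    subset_inter (V_mono inter_subset_left) (V_mono inter_subset_right)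
  have h4 := card_le_card hsub
  have hc2 : (S ∩ T).card ≤ 8 :=
    (card_le_card (inter_subset_left.trans subset_union_left)).trans hc
  have h5 := H.low (inter_subset_left.trans hS.1) hI hc2
  have h6 : s * (S ∪ T).card + s * (S ∩ T).card = s * S.card + s * T.card := by
    rw [← mul_add, h3, mul_add]
  have := hS.2
  have := hT.2
  refine ⟨by omega, (eq_of_subset_of_card_le hsub (by omega)).symm⟩

theorem Good.lemD (H : Good s G) {S T : Finset (Finset α)} {q : Finset α} (hS : Dn s G S)
    (hT : Dn s G T) (hd : Disjoint S T) (hq : q.card = 2) (hqS : q ⊆ V S) (hqT : q ⊆ V T)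
    (hn : S.Nonempty) (hc : S.card + T.card ≤ 8) :
    Dn s G (S ∪ T) ∧ V S ∩ V T = q := by
  have h3 := card_union_of_disjoint hd
  have h1 : s * (S ∪ T).card + 2 ≤ (V (S ∪ T)).card :=
    H.low (union_subset hS.1 hT.1) (hn.mono subset_union_left) (by omega)
  have h2 := card_union_add_card_inter (V S) (V T)
  rw [V_union] at h1
  have hsub : q ⊆ V S ∩ V T := subset_inter hqS hqT
  have h4 := card_le_card hsub
  have h6 : s * (S ∪ T).card = s * S.card + s * T.card := by rw [h3, mul_add]
  have := hS.2
  have := hT.2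
  refine ⟨⟨union_subset hS.1 hT.1, ?_⟩, (eq_of_subset_of_card_le hsub (by omega)).symm⟩
  rw [V_union]; omega

theorem Good.lemE (H : Good s G) {S A : Finset (Finset α)} (hS : Dn s G S) (hc : S.card ≤ 8)
    (hA : A ⊆ G) (hd : Disjoint S A) (h2 : ∀ g ∈ A, 2 ≤ (g ∩ V S).card) :
    S.card + A.card ≤ 7 := by
  by_contra hcon
  obtain ⟨B, hBA, hB⟩ := exists_subset_card_eq (s := A) (n := 8 - S.card) (by omega)
  have key : ∀ B ⊆ A, Dn s G (S ∪ B) := by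
    intro B
    induction B using Finset.induction_on with
    | empty => intro _; simpa using hS
    | insert g B hg ih =>
      intro hsub
      have hB := ih (fun x hx => hsub (mem_insert_of_mem hx))
      have hgA : g ∈ A := hsub (mem_insert_self _ _)
      have hgS : g ∉ S ∪ B := by
        rw [mem_union]; rintro (h | h)
        · exact (disjoint_left.1 hd h) hgA
        · exact hg h
      have e1 : S ∪ insert g B = (S ∪ B) ∪ {g} := by
        ext x; simp
      rw [e1]
      refine ⟨union_subset hB.1 (by simpa using hA hgA), ?_⟩
      rw [V_union, V_single, card_union_of_disjoint (s := S ∪ B) (t := {g})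
        (disjoint_singleton_right.2 hgS)]
      have h3 := card_union_add_card_inter (V (S ∪ B)) g
      have h4 : (g ∩ V S).card ≤ (V (S ∪ B) ∩ g).card := by
        apply card_le_card
        rw [inter_comm]
        exact inter_subset_inter_right (V_mono subset_union_left)
      have h5 := h2 g hgA
      have h6 := H.unif g (hA hgA)
      have h7 := hB.2
      rw [card_singleton, mul_add]; omega
  apply H.ne8 (key B hBA)
  rw [card_union_of_disjoint (hd.mono_right hBA)]; omega

/-- Links: dense pairs of edges. -/
def links (s : ℕ) (G : Finset (Finset α)) : Finset (Finset (Finset α)) :=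
  (G.powersetCard 2).filter (fun L => (V L).card ≤ s * 2 + 2)

/-- Pairs spanned by the edges, but not covered by one of them. -/
def cross (L : Finset (Finset α)) : Finset (Finset α) :=
  ((V L).powersetCard 2).filter (fun q => ∀ e ∈ L, ¬ q ⊆ e)

/-- Cross pairs not covered by any edge. -/
def U (G L : Finset (Finset α)) : Finset (Finset α) :=
  (cross L).filter (fun q => ∀ g ∈ G, ¬ q ⊆ g)

/-- External edges attached to cross pairs. -/
def Ext (G L A : Finset (Finset α)) : Prop := A ⊆ G ∧ ∀ g ∈ A, g ∩ V L ∈ cross L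

theorem mem_links {L : Finset (Finset α)} :
    L ∈ links s G ↔ Dn s G L ∧ L.card = 2 := by
  simp only [links, mem_filter, mem_powersetCard, Dn]
  constructor
  · rintro ⟨⟨h1, h2⟩, h3⟩; exact ⟨⟨h1, by rw [h2]; exact h3⟩, h2⟩
  · rintro ⟨⟨h1, h2⟩, h3⟩; exact ⟨⟨h1, h3⟩, by rw [h3] at h2; exact h2⟩

theorem mem_cross {L : Finset (Finset α)} {q : Finset α} :
    q ∈ cross L ↔ q ⊆ V L ∧ q.card = 2 ∧ ∀ e ∈ L, ¬ q ⊆ e := by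
  simp [cross, mem_powersetCard, and_assoc]

theorem mem_U {L : Finset (Finset α)} {q : Finset α} :
    q ∈ U G L ↔ q ∈ cross L ∧ ∀ g ∈ G, ¬ q ⊆ g := by
  simp [U]

theorem Ext.disj {L A : Finset (Finset α)} (hA : Ext G L A) : Disjoint L A := by
  rw [disjoint_left]
  intro g hg hgA
  exact (mem_cross.1 (hA.2 g hgA)).2.2 g hg inter_subset_left

theorem Ext.two {L A S : Finset (Finset α)} (hA : Ext G L A) (hL : L ⊆ S) :
    ∀ g ∈ A, 2 ≤ (g ∩ V S).card := by
  intro g hg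
  rw [← (mem_cross.1 (hA.2 g hg)).2.1]
  exact card_le_card (inter_subset_inter_left (V_mono hL))

theorem Ext.disj2 {L A S T : Finset (Finset α)} {q : Finset α} (hA : Ext G L A) (hL : L ⊆ S)
    (hq : V S ∩ V T = q) (hqc : q.card = 2) (hu : ∀ g ∈ G, ¬ q ⊆ g) : Disjoint T A := by
  rw [disjoint_left]
  intro g hg hgA
  have h1 := (mem_cross.1 (hA.2 g hgA)).2.1
  have h2 : g ∩ V L ⊆ q := by
    rw [← hq, inter_comm]
    exact inter_subset_inter (V_mono hL) (sub_V hg)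
  have h3 := eq_of_subset_of_card_le h2 (by omega)
  exact hu g (hA.1 hgA) (h3 ▸ inter_subset_left)

theorem Good.link_inter (H : Good s G) {e f : Finset α} (hne : e ≠ f)
    (hL : ({e, f} : Finset (Finset α)) ∈ links s G) : (e ∩ f).card = 2 := by
  obtain ⟨hD, hc⟩ := mem_links.1 hL
  have he : e ∈ G := hD.1 (by simp)
  have hf : f ∈ G := hD.1 (by simp)
  have h1 := hD.2
  have h2 := H.low hD.1 (by simp) (by omega)
  have h3 := card_union_add_card_inter e f
  have h4 : V ({e, f} : Finset (Finset α)) = e ∪ f := by simp [V]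
  rw [h4, hc] at h1 h2
  rw [H.unif e he, H.unif f hf] at h3
  omega

theorem pair_inj {x z x' z' : α} {A B : Finset α} (hd : Disjoint A B) (hx : x ∈ A) (hz : z ∈ B)
    (hx' : x' ∈ A) (hz' : z' ∈ B) (h : ({x, z} : Finset α) = {x', z'}) : x = x' ∧ z = z' := by
  have h1 : x ∈ ({x', z'} : Finset α) := h ▸ (by simp)
  have h2 : z ∈ ({x', z'} : Finset α) := h ▸ (by simp)
  simp only [mem_insert, mem_singleton] at h1 h2
  have n1 : x ≠ z' := fun hh => disjoint_left.1 hd hx (hh ▸ hz')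
  have n2 : z ≠ x' := fun hh => disjoint_left.1 hd hx' (hh ▸ hz)
  tauto

theorem prod_pairs (A B : Finset α) (hd : Disjoint A B) :
    ((A ×ˢ B).image (fun p => ({p.1, p.2} : Finset α))).card = A.card * B.card := by
  rw [card_image_of_injOn, card_product]
  rintro ⟨x, z⟩ h1 ⟨x', z'⟩ h2 h
  simp only [coe_product, Set.mem_prod, mem_coe] at h1 h2
  have := pair_inj hd h1.1 h1.2 h2.1 h2.2 h
  simp [this]

theorem Good.cross_card (H : Good s G) {L : Finset (Finset α)} (hL : L ∈ links s G) :
    4 ≤ (cross L).card := by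
  obtain ⟨e, f, hne, rfl⟩ := card_eq_two.1 (mem_links.1 hL).2
  have hi := H.link_inter hne hL
  have he : e ∈ G := (mem_links.1 hL).1.1 (by simp)
  have hf : f ∈ G := (mem_links.1 hL).1.1 (by simp)
  have h1 : (e \ f).card = s := by
    have := card_sdiff_add_card_inter e f
    rw [H.unif e he] at this; omega
  have h2 : (f \ e).card = s := by
    have := card_sdiff_add_card_inter f e
    rw [H.unif f hf, inter_comm] at this; omega
  have hd : Disjoint (e \ f) (f \ e) := by
    rw [disjoint_left]; intro x; simp; tauto
  have h3 := prod_pairs _ _ hd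
  have h4 : ((e \ f) ×ˢ (f \ e)).image (fun p => ({p.1, p.2} : Finset α)) ⊆ cross {e, f} := by
    intro q hq
    simp only [mem_image, mem_product, mem_sdiff, Prod.exists] at hq
    obtain ⟨x, z, ⟨⟨hx1, hx2⟩, hz1, hz2⟩, rfl⟩ := hq
    rw [mem_cross]
    have hxz : x ≠ z := fun h => hx2 (h ▸ hz1)
    refine ⟨?_, card_pair hxz, ?_⟩
    · intro y hy
      simp only [mem_insert, mem_singleton] at hy
      rcases hy with rfl | rfl
      · exact sub_V (e := e) (by simp) hx1
      · exact sub_V (e := f) (by simp) hz1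
    · intro g hg hs
      simp only [mem_insert, mem_singleton] at hg
      rcases hg with rfl | rfl
      · exact hz2 (hs (by simp))
      · exact hx2 (hs (by simp))
  have h5 := card_le_card h4
  rw [h3, h1, h2] at h5
  have := H.two
  nlinarith

theorem Good.exists_ext (H : Good s G) {L : Finset (Finset α)} (hL : L ∈ links s G) :
    ∃ A, Ext G L A ∧ 4 ≤ A.card + (U G L).card := by
  classical
  obtain ⟨hD, hc⟩ := mem_links.1 hL
  have hch : ∀ q ∈ (cross L).filter (fun q => ¬ ∀ g ∈ G, ¬ q ⊆ g), ∃ g ∈ G, g ∩ V L = q := by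
    intro q hq
    rw [mem_filter] at hq
    obtain ⟨hq, hg⟩ := hq
    push Not at hg
    obtain ⟨g, hg, hqg⟩ := hg
    obtain ⟨hqV, hqc, hqe⟩ := mem_cross.1 hq
    have := (H.lemD hD (H.single hg) (by
      rw [disjoint_singleton_right]; intro h; exact hqe g h hqg) hqc hqV
      (by rwa [V_single]) (card_pos.1 (by omega)) (by simp; omega)).2
    rw [V_single, inter_comm] at this
    exact ⟨g, hg, this⟩
  choose! F hF1 hF2 using hch
  refine ⟨((cross L).filter (fun q => ¬ ∀ g ∈ G, ¬ q ⊆ g)).image F, ⟨?_, ?_⟩, ?_⟩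
  · intro g hg
    obtain ⟨q, hq, rfl⟩ := mem_image.1 hg
    exact hF1 q hq
  · intro g hg
    obtain ⟨q, hq, rfl⟩ := mem_image.1 hg
    rw [hF2 q hq]
    exact (mem_filter.1 hq).1
  · rw [card_image_of_injOn]
    · have := H.cross_card hL
      have h2 := card_filter_add_card_filter_not (s := cross L) (fun q => ∀ g ∈ G, ¬ q ⊆ g)
      unfold U
      omega
    · intro q hq q' hq' h
      rw [← hF2 q hq, ← hF2 q' hq', h]

/-- Two distinct links sharing a cross pair. -/
theorem Good.share (H : Good s G) {L L' : Finset (Finset α)} (hL : L ∈ links s G)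
    (hL' : L' ∈ links s G) (hne : L ≠ L') {q : Finset α} (hq : q ∈ U G L) (hq' : q ∈ U G L') :
    Disjoint L L' ∧ Dn s G (L ∪ L') ∧ V L ∩ V L' = q := by
  obtain ⟨hD, hc⟩ := mem_links.1 hL
  obtain ⟨hD', hc'⟩ := mem_links.1 hL'
  obtain ⟨hqV, hqc, hqe⟩ := mem_cross.1 (mem_U.1 hq).1
  obtain ⟨hqV', -, hqe'⟩ := mem_cross.1 (mem_U.1 hq').1
  have hd : Disjoint L L' := by
    by_contra hcon
    have hI := not_disjoint_iff_nonempty_inter.1 hcon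
    have hcu := card_union_le L L'
    obtain ⟨h1, h2⟩ := H.lemU hD hD' hI (by omega)
    have hqI : q ⊆ V (L ∩ L') := h2 ▸ subset_inter hqV hqV'
    have hlt : (L ∩ L').card < 2 := by
      by_contra h
      have e1 := eq_of_subset_of_card_le (inter_subset_left (s₁ := L) (s₂ := L')) (by omega)
      have e2 := eq_of_subset_of_card_le (inter_subset_right (s₁ := L) (s₂ := L')) (by omega)
      exact hne (e1.symm.trans e2)
    obtain ⟨g, hg⟩ := card_eq_one.1 (show (L ∩ L').card = 1 by have := card_pos.2 hI; omega)
    rw [hg, V_single] at hqI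
    exact hqe g (inter_subset_left (hg ▸ mem_singleton_self g)) hqI
  obtain ⟨h1, h2⟩ := H.lemD hD hD' hd hqc hqV hqV' (card_pos.1 (by omega)) (by omega)
  exact ⟨hd, h1, h2⟩

theorem Good.F1 (H : Good s G) {L L' A A' : Finset (Finset α)} (hL : L ∈ links s G)
    (hL' : L' ∈ links s G) (hne : L ≠ L') {q : Finset α} (hq : q ∈ U G L) (hq' : q ∈ U G L')
    (hA : Ext G L A) (hA' : Ext G L' A') : A.card + A'.card ≤ 3 := by
  obtain ⟨hd, hD, hV⟩ := H.share hL hL' hne hq hq'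
  have hc := (mem_links.1 hL).2
  have hc' := (mem_links.1 hL').2
  obtain ⟨hqX, hu⟩ := mem_U.1 hq
  have hqc := (mem_cross.1 hqX).2.1
  have d1 : Disjoint L' A := hA.disj2 (subset_refl L) hV hqc hu
  have d2 : Disjoint L A' := hA'.disj2 (subset_refl L') (by rw [inter_comm]; exact hV) hqc hu
  have hcu := card_union_of_disjoint hd
  have t1 := hA.two (S := L ∪ L') subset_union_left
  have t2 := hA'.two (S := L ∪ L') subset_union_right
  have d3 : Disjoint (L ∪ L') A := disjoint_union_left.2 ⟨hA.disj, d1⟩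
  have d4 : Disjoint (L ∪ L') A' := disjoint_union_left.2 ⟨d2, hA'.disj⟩
  have d5 : Disjoint A A' := by
    rw [disjoint_left]
    intro g hg hg'
    have hgG := hA.1 hg
    obtain ⟨a1, a2, -⟩ := mem_cross.1 (hA.2 g hg)
    obtain ⟨b1, b2, -⟩ := mem_cross.1 (hA'.2 g hg')
    have hgd : Disjoint (L ∪ L') {g} :=
      disjoint_singleton_right.2 (fun h => disjoint_left.1 d3 h hg)
    have hn : (L ∪ L').Nonempty := card_pos.1 (by omega)
    have k1 := (H.lemD hD (H.single hgG) hgd a2 (a1.trans (V_mono subset_union_left))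
      (by rw [V_single]; exact inter_subset_left) hn (by simp; omega)).2
    have k2 := (H.lemD hD (H.single hgG) hgd b2 (b1.trans (V_mono subset_union_right))
      (by rw [V_single]; exact inter_subset_left) hn (by simp; omega)).2
    have k3 : g ∩ V L = g ∩ V L' := k1.symm.trans k2
    have k4 : g ∩ V L ⊆ q := by
      rw [← hV]; exact subset_inter a1 (k3 ▸ b1)
    have k5 := eq_of_subset_of_card_le k4 (by omega)
    exact hu g hgG (k5 ▸ inter_subset_left)
  have := H.lemE hD (by omega) (union_subset hA.1 hA'.1) (disjoint_union_right.2 ⟨d3, d4⟩)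
    (by
      intro g hg
      rcases mem_union.1 hg with h | h
      · exact t1 g h
      · exact t2 g h)
  rw [card_union_of_disjoint d5] at this
  omega

/-- Three distinct links sharing an uncovered pair. -/
theorem Good.share3 (H : Good s G) {L1 L2 L3 : Finset (Finset α)} (h1 : L1 ∈ links s G)
    (h2 : L2 ∈ links s G) (h3 : L3 ∈ links s G) (h12 : L1 ≠ L2) (h13 : L1 ≠ L3) (h23 : L2 ≠ L3)
    {q : Finset α} (q1 : q ∈ U G L1) (q2 : q ∈ U G L2) (q3 : q ∈ U G L3) :
    Dn s G (L1 ∪ L2 ∪ L3) ∧ (L1 ∪ L2 ∪ L3).card = 6 := by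
  obtain ⟨d12, D12, V12⟩ := H.share h1 h2 h12 q1 q2
  obtain ⟨d13, D13, V13⟩ := H.share h1 h3 h13 q1 q3
  obtain ⟨d23, D23, V23⟩ := H.share h2 h3 h23 q2 q3
  have hd : Disjoint (L1 ∪ L2) L3 := disjoint_union_left.2 ⟨d13, d23⟩
  have c1 := (mem_links.1 h1).2
  have c2 := (mem_links.1 h2).2
  have c3 := (mem_links.1 h3).2
  have c12 := card_union_of_disjoint d12
  have c123 := card_union_of_disjoint hd
  obtain ⟨a1, a2, -⟩ := mem_cross.1 (mem_U.1 q1).1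
  obtain ⟨b1, -, -⟩ := mem_cross.1 (mem_U.1 q3).1
  exact ⟨(H.lemD D12 (mem_links.1 h3).1 hd a2 (a1.trans (V_mono subset_union_left)) b1
    (card_pos.1 (by omega)) (by omega)).1, by omega⟩

theorem Good.F2 (H : Good s G) {L1 L2 L3 A : Finset (Finset α)} (h1 : L1 ∈ links s G)
    (h2 : L2 ∈ links s G) (h3 : L3 ∈ links s G) (h12 : L1 ≠ L2) (h13 : L1 ≠ L3) (h23 : L2 ≠ L3)
    {q : Finset α} (q1 : q ∈ U G L1) (q2 : q ∈ U G L2) (q3 : q ∈ U G L3)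
    (hA : Ext G L1 A) : A.card ≤ 1 := by
  obtain ⟨hD, hc⟩ := H.share3 h1 h2 h3 h12 h13 h23 q1 q2 q3
  obtain ⟨hqX, hu⟩ := mem_U.1 q1
  have hqc := (mem_cross.1 hqX).2.1
  have d2 := hA.disj2 (subset_refl _) (H.share h1 h2 h12 q1 q2).2.2 hqc hu
  have d3 := hA.disj2 (subset_refl _) (H.share h1 h3 h13 q1 q3).2.2 hqc hu
  have := H.lemE hD (by omega) hA.1
    (disjoint_union_left.2 ⟨disjoint_union_left.2 ⟨hA.disj, d2⟩, d3⟩)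
    (hA.two (subset_union_left.trans subset_union_left))
  omega

theorem Good.F3 (H : Good s G) {L1 L2 L3 L4 : Finset (Finset α)} (h1 : L1 ∈ links s G)
    (h2 : L2 ∈ links s G) (h3 : L3 ∈ links s G) (h4 : L4 ∈ links s G)
    (h12 : L1 ≠ L2) (h13 : L1 ≠ L3) (h14 : L1 ≠ L4) (h23 : L2 ≠ L3) (h24 : L2 ≠ L4)
    (h34 : L3 ≠ L4)
    {q : Finset α} (q1 : q ∈ U G L1) (q2 : q ∈ U G L2) (q3 : q ∈ U G L3) (q4 : q ∈ U G L4) :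
    False := by
  obtain ⟨hD, hc⟩ := H.share3 h1 h2 h3 h12 h13 h23 q1 q2 q3
  have hd : Disjoint (L1 ∪ L2 ∪ L3) L4 := disjoint_union_left.2 ⟨disjoint_union_left.2
    ⟨(H.share h1 h4 h14 q1 q4).1, (H.share h2 h4 h24 q2 q4).1⟩, (H.share h3 h4 h34 q3 q4).1⟩
  have c4 := (mem_links.1 h4).2
  obtain ⟨a1, a2, -⟩ := mem_cross.1 (mem_U.1 q1).1
  obtain ⟨b1, -, -⟩ := mem_cross.1 (mem_U.1 q4).1
  have := H.lemD hD (mem_links.1 h4).1 hd a2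
    (a1.trans (V_mono (subset_union_left.trans subset_union_left))) b1
    (card_pos.1 (by omega)) (by omega)
  apply H.ne8 this.1
  rw [card_union_of_disjoint hd]; omega

/-- `L` has two external edges, shares `q` with `L'`, which shares `q2` with `L2`. -/
theorem Good.F4 (H : Good s G) {L L' L2 A : Finset (Finset α)} (h : L ∈ links s G)
    (h' : L' ∈ links s G) (h2 : L2 ∈ links s G) (hne : L' ≠ L) (hne2 : L' ≠ L2) (hne3 : L ≠ L2)
    {q q2 : Finset α} (hq : q ∈ U G L) (hq' : q ∈ U G L') (hq2' : q2 ∈ U G L')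
    (hq2 : q2 ∈ U G L2) (hA : Ext G L A) : A.card ≤ 1 := by
  obtain ⟨d1, D1, V1⟩ := H.share h' h hne hq' hq
  obtain ⟨d2, D2, V2⟩ := H.share h' h2 hne2 hq2' hq2
  have c := (mem_links.1 h).2
  have c' := (mem_links.1 h').2
  have c2 := (mem_links.1 h2).2
  have c1 := card_union_of_disjoint d1
  obtain ⟨hqX, hu⟩ := mem_U.1 hq
  have hqc := (mem_cross.1 hqX).2.1
  obtain ⟨hqX2, hu2⟩ := mem_U.1 hq2
  obtain ⟨hqV2, hqc2, hqe2⟩ := mem_cross.1 hqX2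
  have hqV' := (mem_cross.1 (mem_U.1 hq2').1).1
  have hqS : q2 ⊆ V (L' ∪ L) := hqV'.trans (V_mono subset_union_left)
  have hd : Disjoint (L' ∪ L) L2 := by
    by_contra hcon
    have hI := not_disjoint_iff_nonempty_inter.1 hcon
    have hcu := card_union_le (L' ∪ L) L2
    obtain ⟨k1, k2⟩ := H.lemU D1 (mem_links.1 h2).1 hI (by omega)
    have hqI : q2 ⊆ V ((L' ∪ L) ∩ L2) := k2 ▸ subset_inter hqS hqV2
    have hI2 : (L' ∪ L) ∩ L2 = L ∩ L2 := by
      rw [union_inter_distrib_right, disjoint_iff_inter_eq_empty.1 d2, empty_union]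
    rw [hI2] at hqI hI
    have hlt : (L ∩ L2).card < 2 := by
      by_contra h
      have e1 := eq_of_subset_of_card_le (inter_subset_left (s₁ := L) (s₂ := L2)) (by omega)
      have e2 := eq_of_subset_of_card_le (inter_subset_right (s₁ := L) (s₂ := L2)) (by omega)
      exact hne3 (e1.symm.trans e2)
    obtain ⟨g, hg⟩ := card_eq_one.1 (show (L ∩ L2).card = 1 by have := card_pos.2 hI; omega)
    rw [hg, V_single] at hqI
    exact hqe2 g (inter_subset_right (hg ▸ mem_singleton_self g)) hqI
  obtain ⟨D, VV⟩ := H.lemD D1 (mem_links.1 h2).1 hd hqc2 hqS hqV2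
    (card_pos.1 (by omega)) (by omega)
  have e1 : Disjoint L2 A := hA.disj2 subset_union_right VV hqc2 hu2
  have e2 : Disjoint L' A := hA.disj2 (subset_refl _) (by rw [inter_comm]; exact V1) hqc hu
  have cc := card_union_of_disjoint hd
  have := H.lemE D (by omega) hA.1
    (disjoint_union_left.2 ⟨disjoint_union_left.2 ⟨e2, hA.disj⟩, e1⟩)
    (hA.two (subset_union_right.trans subset_union_left))
  omega

/-- Candidate pairs for a link all of whose cross pairs may be covered. -/
structure Cand (G L : Finset (Finset α)) (g q : Finset α) : Prop where
  ext : ∃ A, Ext G L A ∧ 4 ≤ A.card ∧ g ∈ A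
  qc : q.card = 2
  qV : q ⊆ V (L ∪ {g})
  qL : ¬ q ⊆ V L
  unc : ∀ h ∈ G, ¬ q ⊆ h

theorem Good.T_dense (H : Good s G) {L A : Finset (Finset α)} {g : Finset α}
    (hL : L ∈ links s G) (hA : Ext G L A) (hg : g ∈ A) :
    Dn s G (L ∪ {g}) ∧ (L ∪ {g}).card = 3 := by
  obtain ⟨hD, hc⟩ := mem_links.1 hL
  have hd : Disjoint L {g} := disjoint_singleton_right.2 (fun h => disjoint_left.1 hA.disj h hg)
  obtain ⟨a, b, -⟩ := mem_cross.1 (hA.2 g hg)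
  refine ⟨(H.lemD hD (H.single (hA.1 hg)) hd b a (by rw [V_single]; exact inter_subset_left)
    (card_pos.1 (by omega)) (by simp; omega)).1, ?_⟩
  rw [card_union_of_disjoint hd]; simp; omega

theorem Good.lemJ (H : Good s G) {L A I : Finset (Finset α)} {g : Finset α}
    (hL : L ∈ links s G) (hA : Ext G L A) (hg : g ∈ A) (hI : I ⊆ L ∪ {g}) (hc : I.card = 2)
    (hD : (V I).card ≤ s * I.card + 2) : I = L := by
  have hcL := (mem_links.1 hL).2
  have hLG := (mem_links.1 hL).1.1
  have hgI : g ∉ I := by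
    intro hgI
    have h1 : (I.erase g).card = 1 := by rw [card_erase_of_mem hgI]; omega
    obtain ⟨e, he⟩ := card_eq_one.1 h1
    have heI : e ∈ I.erase g := he ▸ mem_singleton_self e
    have heg : e ≠ g := (mem_erase.1 heI).1
    have heL : e ∈ L := by
      have := hI (mem_erase.1 heI).2
      rw [mem_union, mem_singleton] at this
      tauto
    obtain ⟨a, b, c⟩ := mem_cross.1 (hA.2 g hg)
    have hss : e ∩ g ⊂ g ∩ V L := by
      rw [ssubset_iff_subset_ne]
      refine ⟨?_, ?_⟩
      · rw [inter_comm]; exact inter_subset_inter_left (sub_V heL)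
      · intro h; exact c e heL (h ▸ inter_subset_left)
    have h2 := card_lt_card hss
    have h3 := card_union_add_card_inter e g
    rw [H.unif e (hLG heL), H.unif g (hA.1 hg)] at h3
    have h4 : (e ∪ g).card ≤ (V I).card :=
      card_le_card (union_subset (sub_V (mem_erase.1 heI).2) (sub_V hgI))
    rw [hc] at hD
    omega
  refine eq_of_subset_of_card_le ?_ (by omega)
  intro e he
  have := hI he
  rw [mem_union, mem_singleton] at this
  rcases this with h | rfl
  · exact h
  · exact absurd he hgI

theorem Good.lemI (H : Good s G) {L I : Finset (Finset α)} {g q : Finset α}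
    (hL : L ∈ links s G) (hC : Cand G L g q) (hI : I ⊆ L ∪ {g}) (hq : q ⊆ V I)
    (hD : (V I).card ≤ s * I.card + 2) : I = L ∪ {g} := by
  obtain ⟨A, hA, -, hg⟩ := hC.ext
  obtain ⟨hT, hTc⟩ := H.T_dense hL hA hg
  have hle := card_le_card hI
  by_contra hne
  have hlt : I.card < 3 := by
    by_contra h
    exact hne (eq_of_subset_of_card_le hI (by omega))
  have hcases : I.card = 0 ∨ I.card = 1 ∨ I.card = 2 := by omega
  rcases hcases with h | h | h
  · rw [card_eq_zero] at h
    subst h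
    have := card_le_card hq
    rw [hC.qc] at this
    simp [V] at this
  · obtain ⟨e, rfl⟩ := card_eq_one.1 h
    rw [V_single] at hq
    exact hC.unc e (hT.1 (hI (mem_singleton_self e))) hq
  · have := H.lemJ hL hA hg hI h hD
    subst this
    exact hC.qL hq

/-- A candidate shares its pair with no dense set of at most three edges,
unless that set consists of the same triple. -/
theorem Good.cand_dense (H : Good s G) {L T' : Finset (Finset α)} {g q : Finset α}
    (hL : L ∈ links s G) (hC : Cand G L g q) (hT' : Dn s G T') (hc2 : 2 ≤ T'.card)
    (hc3 : T'.card ≤ 3) (hq : q ⊆ V T') : T' = L ∪ {g} := by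
  obtain ⟨A, hA, hA4, hg⟩ := hC.ext
  obtain ⟨hT, hTc⟩ := H.T_dense hL hA hg
  have hcu := card_union_le (L ∪ {g}) T'
  by_cases hd : Disjoint (L ∪ {g}) T'
  · exfalso
    obtain ⟨D, VV⟩ := H.lemD hT hT' hd hC.qc hC.qV hq (card_pos.1 (by omega)) (by omega)
    have d1 : Disjoint T' A := hA.disj2 subset_union_left VV hC.qc hC.unc
    have cc := card_union_of_disjoint hd
    have := H.lemE (A := A.erase g) D (by omega) ((erase_subset _ _).trans hA.1)
      (disjoint_union_left.2 ⟨disjoint_union_left.2 ⟨hA.disj.mono_right (erase_subset _ _),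
        by simp⟩, d1.mono_right (erase_subset _ _)⟩)
      (fun x hx => hA.two (subset_union_left.trans subset_union_left) x (mem_of_mem_erase hx))
    rw [card_erase_of_mem hg] at this
    omega
  · have hI := not_disjoint_iff_nonempty_inter.1 hd
    obtain ⟨k1, k2⟩ := H.lemU hT hT' hI (by omega)
    have hqI : q ⊆ V ((L ∪ {g}) ∩ T') := k2 ▸ subset_inter hC.qV hq
    have := H.lemI hL hC inter_subset_left hqI k1
    have hsub : L ∪ {g} ⊆ T' := by rw [← this]; exact inter_subset_right
    exact (eq_of_subset_of_card_le hsub (by omega)).symm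

theorem Good.F5b (H : Good s G) {L L' : Finset (Finset α)} {g q : Finset α}
    (hL : L ∈ links s G) (hC : Cand G L g q) (hL' : L' ∈ links s G) : q ∉ U G L' := by
  intro hq
  obtain ⟨hD, hc⟩ := mem_links.1 hL'
  have h1 := H.cand_dense hL hC hD (by omega) (by omega) (mem_cross.1 (mem_U.1 hq).1).1
  obtain ⟨A, hA, hA4, hg⟩ := hC.ext
  have := (H.T_dense hL hA hg).2
  rw [← h1] at this
  omega

theorem Good.F5c (H : Good s G) {L L' : Finset (Finset α)} {g g' q : Finset α}
    (hL : L ∈ links s G) (hC : Cand G L g q) (hL' : L' ∈ links s G) (hC' : Cand G L' g' q) :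
    L' = L := by
  obtain ⟨A, hA, hA4, hg⟩ := hC.ext
  obtain ⟨A', hA', hA4', hg'⟩ := hC'.ext
  obtain ⟨hT', hTc'⟩ := H.T_dense hL' hA' hg'
  have h1 := H.cand_dense hL hC hT' (by omega) (by omega) hC'.qV
  obtain ⟨hD, hc⟩ := mem_links.1 hL'
  exact H.lemJ hL hA hg (h1 ▸ subset_union_left) hc hD.2

theorem Good.exists_cand (H : Good s G) {L : Finset (Finset α)} (hL : L ∈ links s G)
    (hU : U G L = ∅) : ∃ g q, Cand G L g q := by
  obtain ⟨A, hA, h4⟩ := H.exists_ext hL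
  rw [hU, card_empty, add_zero] at h4
  obtain ⟨g, hg⟩ : A.Nonempty := card_pos.1 (by omega)
  obtain ⟨hT, hTc⟩ := H.T_dense hL hA hg
  obtain ⟨hD, hc⟩ := mem_links.1 hL
  obtain ⟨a, b, c⟩ := mem_cross.1 (hA.2 g hg)
  have hs := H.two
  obtain ⟨p, hp⟩ : (g \ V L).Nonempty := by
    apply card_pos.1
    have := card_sdiff_add_card_inter g (V L)
    rw [H.unif g (hA.1 hg)] at this
    omega
  have hY : 1 < (V L \ g).card := by
    have h1 := card_sdiff_add_card_inter (V L) g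
    have h2 := H.low hD.1 (card_pos.1 (by omega)) (by omega)
    rw [inter_comm] at h1
    rw [hc] at h2
    omega
  obtain ⟨y1, hy1, y2, hy2, hne⟩ := one_lt_card.1 hY
  rw [mem_sdiff] at hp
  have hpV : p ∈ V (L ∪ {g}) := sub_V (e := g) (by simp) hp.1
  have hdA : Disjoint (L ∪ {g}) (A.erase g) :=
    disjoint_union_left.2 ⟨hA.disj.mono_right (erase_subset _ _), by simp⟩
  by_contra hcon
  have key : ∀ y ∈ V L \ g, ∃ h ∈ G, h ∉ L ∪ {g} ∧ h ∉ A ∧ h ∩ V (L ∪ {g}) = {p, y} := by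
    intro y hy
    rw [mem_sdiff] at hy
    have hpy : p ≠ y := fun h => hy.2 (h ▸ hp.1)
    have hqV : ({p, y} : Finset α) ⊆ V (L ∪ {g}) := by
      intro x hx
      rw [mem_insert, mem_singleton] at hx
      rcases hx with rfl | rfl
      · exact hpV
      · exact V_mono subset_union_left hy.1
    have hex : ∃ h ∈ G, ({p, y} : Finset α) ⊆ h := by
      by_contra hno
      push Not at hno
      exact hcon ⟨g, {p, y}, ⟨A, hA, h4, hg⟩, card_pair hpy, hqV,
        fun h => hp.2 (h (by simp)), hno⟩
    obtain ⟨h, hhG, hsub⟩ := hex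
    have hh : h ∉ L ∪ {g} := by
      rw [mem_union, mem_singleton]
      rintro (hh | rfl)
      · exact hp.2 (sub_V hh (hsub (by simp)))
      · exact hy.2 (hsub (by simp))
    have VV := (H.lemD hT (H.single hhG) (disjoint_singleton_right.2 hh) (card_pair hpy) hqV
      (by rwa [V_single]) (card_pos.1 (by omega)) (by rw [card_singleton]; omega)).2
    rw [V_single, inter_comm] at VV
    refine ⟨h, hhG, hh, ?_, VV⟩
    intro hhA
    have h1 : h ∩ V L ⊆ {p, y} := by
      rw [← VV]; exact inter_subset_inter_left (V_mono subset_union_left)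
    have h2 := eq_of_subset_of_card_le h1
      (by rw [(mem_cross.1 (hA.2 h hhA)).2.1, card_pair hpy])
    have h3 : p ∈ h ∩ V L := h2 ▸ (by simp)
    exact hp.2 (mem_inter.1 h3).2
  obtain ⟨h1, a1, b1, c1, d1⟩ := key y1 hy1
  obtain ⟨h2, a2, b2, c2, d2⟩ := key y2 hy2
  have py1 : p ≠ y1 := fun h => (mem_sdiff.1 hy1).2 (h ▸ hp.1)
  have py2 : p ≠ y2 := fun h => (mem_sdiff.1 hy2).2 (h ▸ hp.1)
  have h12 : h1 ≠ h2 := by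
    rintro rfl
    rw [d1] at d2
    have : y1 ∈ ({p, y2} : Finset α) := d2 ▸ (by simp)
    rw [mem_insert, mem_singleton] at this
    rcases this with h | h
    · exact py1 h.symm
    · exact hne h
  have e1 : h2 ∉ A.erase g := fun h => c2 (mem_of_mem_erase h)
  have e2 : h1 ∉ insert h2 (A.erase g) := by
    rw [mem_insert]; rintro (h | h)
    · exact h12 h
    · exact c1 (mem_of_mem_erase h)
  have := H.lemE (A := insert h1 (insert h2 (A.erase g))) hT (by omega)
    (by
      intro x hx
      rw [mem_insert, mem_insert] at hx
      rcases hx with rfl | rfl | hx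
      · exact a1
      · exact a2
      · exact hA.1 (mem_of_mem_erase hx))
    (by
      rw [disjoint_insert_right, disjoint_insert_right]
      exact ⟨b1, b2, hdA⟩)
    (by
      intro x hx
      rw [mem_insert, mem_insert] at hx
      rcases hx with rfl | rfl | hx
      · rw [d1, card_pair py1]
      · rw [d2, card_pair py2]
      · exact hA.two subset_union_left x (mem_of_mem_erase hx))
  rw [card_insert_of_notMem e2, card_insert_of_notMem e1, card_erase_of_mem hg] at this
  omega

theorem weight {X Y : Type*} [DecidableEq X] [DecidableEq Y] (P : Finset X) (Q : Finset Y)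
    (R : X → Y → Prop) [∀ x y, Decidable (R x y)]
    (h : ∀ x ∈ P, ∃ B ⊆ Q, B.Nonempty ∧ ∀ y ∈ B, R x y ∧ (P.filter (fun x => R x y)).card ≤ B.card) :
    P.card ≤ Q.card := by
  have h1 : (P.card : ℚ) ≤ ∑ x ∈ P, ∑ y ∈ Q,
      if R x y then (1 : ℚ) / (P.filter (fun x => R x y)).card else 0 := by
    rw [card_eq_sum_ones, Nat.cast_sum]
    apply sum_le_sum
    intro x hx
    obtain ⟨B, hBQ, hBn, hB⟩ := h x hx
    have hBpos : (0 : ℚ) < B.card := by exact_mod_cast card_pos.2 hBn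
    calc ((1 : ℕ) : ℚ) = ∑ y ∈ B, (1 : ℚ) / B.card := by
          rw [sum_const, nsmul_eq_mul]; field_simp; simp
      _ ≤ ∑ y ∈ B, if R x y then (1 : ℚ) / (P.filter (fun x => R x y)).card else 0 := by
          apply sum_le_sum
          intro y hy
          obtain ⟨hR, hm⟩ := hB y hy
          rw [if_pos hR]
          have : 0 < (P.filter (fun x => R x y)).card := card_pos.2 ⟨x, by simp [hx, hR]⟩
          apply one_div_le_one_div_of_le
          · exact_mod_cast this
          · exact_mod_cast hm
      _ ≤ _ := by
          apply sum_le_sum_of_subset_of_nonneg hBQ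
          intro y _ _
          split_ifs
          · positivity
          · exact le_refl _
  have h2 : ∑ x ∈ P, ∑ y ∈ Q,
      (if R x y then (1 : ℚ) / (P.filter (fun x => R x y)).card else 0) ≤ Q.card := by
    rw [sum_comm, card_eq_sum_ones, Nat.cast_sum]
    apply sum_le_sum
    intro y _
    rw [← sum_filter, sum_const, nsmul_eq_mul, mul_one_div]
    simpa using div_self_le_one _
  exact_mod_cast h1.trans h2

theorem four_of_card {X : Type*} [DecidableEq X] {P : Finset X} {x : X} (hx : x ∈ P)
    (h : 3 ≤ P.card) : ∃ y z, y ∈ P ∧ z ∈ P ∧ x ≠ y ∧ x ≠ z ∧ y ≠ z := by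
  have : 1 < (P.erase x).card := by rw [card_erase_of_mem hx]; omega
  obtain ⟨y, hy, z, hz, hne⟩ := one_lt_card.1 this
  rw [mem_erase] at hy hz
  exact ⟨y, z, hy.2, hz.2, hy.1.symm, hz.1.symm, hne⟩

theorem Good.links_le [Fintype α] (H : Good s G) :
    (links s G).card ≤
      (((univ : Finset α).powersetCard 2).filter (fun q => ∀ g ∈ G, ¬ q ⊆ g)).card := by
  classical
  have hex : ∀ L, L ∈ links s G ∧ U G L = ∅ → ∃ q g, Cand G L g q := by
    rintro L ⟨hL, hU⟩
    obtain ⟨g, q, h⟩ := H.exists_cand hL hU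
    exact ⟨q, g, h⟩
  choose! c gg hc using hex
  have hUunc : ∀ L, U G L ⊆ ((univ : Finset α).powersetCard 2).filter
      (fun q => ∀ g ∈ G, ¬ q ⊆ g) := by
    intro L q hq
    obtain ⟨h1, h2⟩ := mem_U.1 hq
    simp only [mem_filter, mem_powersetCard, subset_univ, true_and]
    exact ⟨(mem_cross.1 h1).2.1, h2⟩
  apply weight (links s G) _ (fun L q => (U G L = ∅ ∧ q = c L) ∨
    (q ∈ U G L ∧ ((U G L).card = 1 ∨ ∀ L' ∈ links s G, q ∈ U G L' → (U G L').card ≠ 1)))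
  intro L hL
  rcases Nat.lt_or_ge (U G L).card 2 with hlt | hge
  · rcases Nat.eq_zero_or_pos (U G L).card with h0 | hpos
    · -- no uncovered cross pair
      rw [card_eq_zero] at h0
      have hC := hc L ⟨hL, h0⟩
      refine ⟨{c L}, ?_, by simp, ?_⟩
      · intro q hq
        rw [mem_singleton] at hq
        subst hq
        simp only [mem_filter, mem_powersetCard, subset_univ, true_and]
        exact ⟨hC.qc, hC.unc⟩
      · intro q hq
        rw [mem_singleton] at hq
        subst hq
        refine ⟨Or.inl ⟨h0, rfl⟩, ?_⟩
        refine (card_le_card (t := {L}) ?_).trans (by simp)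
        intro L' hL'
        rw [mem_filter] at hL'
        obtain ⟨hL', ⟨h0', heq⟩ | ⟨hq, -⟩⟩ := hL'
        · have hC' := hc L' ⟨hL', h0'⟩
          rw [← heq] at hC'
          rw [mem_singleton]
          exact H.F5c hL hC hL' hC'
        · exact absurd hq (H.F5b hL hC hL')
    · -- exactly one uncovered cross pair
      have h1 : (U G L).card = 1 := by omega
      refine ⟨U G L, hUunc L, card_pos.1 hpos, ?_⟩
      intro q hq
      refine ⟨Or.inr ⟨hq, Or.inl h1⟩, ?_⟩
      refine (card_le_card (t := {L}) ?_).trans (by rw [card_singleton]; omega)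
      intro L' hL'
      rw [mem_filter] at hL'
      obtain ⟨hL', ⟨h0', heq⟩ | ⟨hq', h⟩⟩ := hL'
      · have hC' := hc L' ⟨hL', h0'⟩
        rw [← heq] at hC'
        exact absurd hq (H.F5b hL' hC' hL)
      · rw [mem_singleton]
        by_contra hne
        rcases h with h | h
        · obtain ⟨A, hA, hA4⟩ := H.exists_ext hL
          obtain ⟨A', hA', hA4'⟩ := H.exists_ext hL'
          have := H.F1 hL' hL hne hq' hq hA' hA
          omega
        · exact h L hL hq h1
  · -- at least two uncovered cross pairs
    obtain ⟨A, hA, hA4⟩ := H.exists_ext hL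
    set B := (U G L).filter (fun q => ∀ L' ∈ links s G, q ∈ U G L' → (U G L').card ≠ 1) with hB
    have hM : ∀ q ∈ U G L, (links s G).filter (fun L => (U G L = ∅ ∧ q = c L) ∨
        (q ∈ U G L ∧ ((U G L).card = 1 ∨ ∀ L' ∈ links s G, q ∈ U G L' → (U G L').card ≠ 1)))
        ⊆ (links s G).filter (fun L => q ∈ U G L) := by
      intro q hq L' hL'
      rw [mem_filter] at hL' ⊢
      obtain ⟨hL', ⟨h0', heq⟩ | ⟨hq', h⟩⟩ := hL'
      · have hC' := hc L' ⟨hL', h0'⟩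
        rw [← heq] at hC'
        exact absurd hq (H.F5b hL' hC' hL)
      · exact ⟨hL', hq'⟩
    have hM3 : ∀ q ∈ U G L, ((links s G).filter (fun L => q ∈ U G L)).card ≤ 3 := by
      intro q hq
      by_contra hcon
      have hLm : L ∈ (links s G).filter (fun L => q ∈ U G L) := mem_filter.2 ⟨hL, hq⟩
      have hcard : 3 ≤ (((links s G).filter (fun L => q ∈ U G L)).erase L).card := by
        rw [card_erase_of_mem hLm]; omega
      obtain ⟨L1, hL1⟩ : (((links s G).filter (fun L => q ∈ U G L)).erase L).Nonempty :=
        card_pos.1 (by omega)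
      obtain ⟨L2, L3, h2, h3, n12, n13, n23⟩ := four_of_card hL1 hcard
      rw [mem_erase, mem_filter] at hL1 h2 h3
      exact H.F3 hL hL1.2.1 h2.2.1 h3.2.1 hL1.1.symm h2.1.symm h3.1.symm n12 n13 n23 hq
        hL1.2.2 h2.2.2 h3.2.2
    have hM2 : (U G L).card = 2 →
        ∀ q ∈ U G L, ((links s G).filter (fun L => q ∈ U G L)).card ≤ 2 := by
      intro h2 q hq
      by_contra hcon
      have hLm : L ∈ (links s G).filter (fun L => q ∈ U G L) := mem_filter.2 ⟨hL, hq⟩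
      obtain ⟨L2, L3, h2, h3, n12, n13, n23⟩ := four_of_card hLm (by omega)
      rw [mem_filter] at h2 h3
      have := H.F2 hL h2.1 h3.1 n12 n13 n23 hq h2.2 h3.2 hA
      omega
    have hcases : 3 ≤ B.card ∨ (B.card = 2 ∧ (U G L).card = 2) := by
      by_cases hall : U G L \ B = ∅
      · have hsub : U G L ⊆ B := sdiff_eq_empty_iff_subset.1 hall
        have := card_le_card hsub
        have h2 : B.card ≤ (U G L).card := card_le_card (filter_subset _ _)
        omega
      · left
        have lost : ∀ q ∈ U G L \ B, ∃ L' ∈ links s G, q ∈ U G L' ∧ (U G L').card = 1 := by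
          intro q hq
          rw [mem_sdiff, hB, mem_filter] at hq
          obtain ⟨h1, h2⟩ := hq
          by_contra hno
          push Not at hno
          exact h2 ⟨h1, hno⟩
        obtain ⟨q, hq⟩ := nonempty_iff_ne_empty.2 hall
        obtain ⟨L0, hL0, hq0, h01⟩ := lost q hq
        have hqU := (mem_sdiff.1 hq).1
        have hne0 : L ≠ L0 := by rintro rfl; omega
        obtain ⟨A0, hA0, hA04⟩ := H.exists_ext hL0
        have := H.F1 hL hL0 hne0 hqU hq0 hA hA0
        have hone : (U G L \ B).card ≤ 1 := by
          rw [← card_singleton q]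
          apply card_le_card
          intro q2 hq2
          rw [mem_singleton]
          by_contra hne
          obtain ⟨L2, hL2, hq22, h21⟩ := lost q2 hq2
          have hne2 : L ≠ L2 := by rintro rfl; omega
          have hne3 : L0 ≠ L2 := by
            rintro rfl
            exact hne (card_le_one.1 h01.le q2 hq22 q hq0)
          have := H.F4 hL0 hL hL2 hne0 hne2 hne3 hq0 hqU (mem_sdiff.1 hq2).1 hq22 hA0
          omega
        have := card_sdiff_add_card_eq_card (filter_subset
          (fun q => ∀ L' ∈ links s G, q ∈ U G L' → (U G L').card ≠ 1) (U G L))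
        rw [← hB] at this
        omega
    refine ⟨B, (filter_subset _ _).trans (hUunc L), card_pos.1 (by omega), ?_⟩
    intro q hq
    obtain ⟨hqU, hqn⟩ := mem_filter.1 hq
    refine ⟨Or.inr ⟨hqU, Or.inr hqn⟩, (card_le_card (hM q hqU)).trans ?_⟩
    rcases hcases with h | ⟨h, h'⟩
    · exact (hM3 q hqU).trans h
    · exact (hM2 h' q hqU).trans h.ge

theorem Good.pairs_links [Fintype α] (H : Good s G) :
    ∑ q ∈ (univ : Finset α).powersetCard 2, ((G.filter (fun e => q ⊆ e)).powersetCard 2).card ≤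
      (links s G).card := by
  rw [← card_biUnion]
  · apply card_le_card
    intro L hL
    simp only [mem_biUnion, mem_powersetCard, subset_univ, true_and] at hL
    obtain ⟨q, hq, hLs, hLc⟩ := hL
    rw [mem_links]
    have hLG : L ⊆ G := hLs.trans (filter_subset _ _)
    refine ⟨⟨hLG, ?_⟩, hLc⟩
    obtain ⟨e, f, hne, rfl⟩ := card_eq_two.1 hLc
    have he := (mem_filter.1 (hLs (show e ∈ _ by simp)))
    have hf := (mem_filter.1 (hLs (show f ∈ _ by simp)))
    have h4 : V ({e, f} : Finset (Finset α)) = e ∪ f := by simp [V]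
    have h3 := card_union_add_card_inter e f
    have h5 := card_le_card (subset_inter he.2 hf.2)
    rw [H.unif e he.1, H.unif f hf.1] at h3
    rw [h4, hLc]; omega
  · intro q hq q' hq' hne
    rw [Function.onFun, disjoint_left]
    intro L hL hL'
    apply hne
    simp only [mem_coe, mem_powersetCard] at hL hL' hq hq'
    obtain ⟨hLs, hLc⟩ := hL
    obtain ⟨hLs', -⟩ := hL'
    obtain ⟨e, f, hef, rfl⟩ := card_eq_two.1 hLc
    have he := (mem_filter.1 (hLs (show e ∈ _ by simp)))
    have hf := (mem_filter.1 (hLs (show f ∈ _ by simp)))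
    have he' := (mem_filter.1 (hLs' (show e ∈ _ by simp)))
    have hf' := (mem_filter.1 (hLs' (show f ∈ _ by simp)))
    have h4 : V ({e, f} : Finset (Finset α)) = e ∪ f := by simp [V]
    have h3 := card_union_add_card_inter e f
    rw [H.unif e he.1, H.unif f hf.1] at h3
    have h6 := H.low (hLs.trans (filter_subset _ _)) (by simp) (by omega)
    rw [h4, hLc] at h6
    have hq2 : q.card = 2 := by simpa using hq
    have hq2' : q'.card = 2 := by simpa using hq'
    have k1 := eq_of_subset_of_card_le (subset_inter he.2 hf.2) (by omega)
    have k2 := eq_of_subset_of_card_le (subset_inter he'.2 hf'.2) (by omega)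
    exact k1.trans k2.symm

theorem Good.main [Fintype α] (H : Good s G) :
    G.card * (s + 2).choose 2 ≤ (Fintype.card α).choose 2 := by
  have h1 : G.card * (s + 2).choose 2 =
      ∑ q ∈ (univ : Finset α).powersetCard 2, (G.filter (fun e => q ⊆ e)).card := by
    have : ∀ e ∈ G, (((univ : Finset α).powersetCard 2).filter (fun q => q ⊆ e)).card
        = (s + 2).choose 2 := by
      intro e he
      rw [← H.unif e he, ← card_powersetCard]
      congr 1
      ext q
      simp [mem_powersetCard, and_comm]
    rw [← smul_eq_mul, ← sum_const, ← sum_congr rfl this]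
    exact sum_card_bipartiteAbove_eq_sum_card_bipartiteBelow (fun (e q : Finset α) => q ⊆ e)
  have h2 : ∑ q ∈ (univ : Finset α).powersetCard 2, (G.filter (fun e => q ⊆ e)).card ≤
      ∑ q ∈ (univ : Finset α).powersetCard 2,
        (((G.filter (fun e => q ⊆ e)).powersetCard 2).card +
          if ¬ (∀ g ∈ G, ¬ q ⊆ g) then 1 else 0) := by
    apply sum_le_sum
    intro q _
    rw [card_powersetCard]
    by_cases h : ∀ g ∈ G, ¬ q ⊆ g
    · rw [filter_eq_empty_iff.2 (fun g hg => h g hg)]; simp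
    · rw [if_pos h]
      rcases hd : (G.filter (fun e => q ⊆ e)).card with _ | d
      · omega
      · rw [Nat.choose_succ_succ, Nat.choose_one_right]; omega
  rw [sum_add_distrib, ← card_filter] at h2
  have h3 := H.pairs_links
  have h4 := H.links_le
  have h5 := card_filter_add_card_filter_not (s := (univ : Finset α).powersetCard 2)
    (fun q => ∀ g ∈ G, ¬ q ⊆ g)
  rw [card_powersetCard, card_univ] at h5
  omega

end BES

/-- If an `r`-graph (`r ≥ 4`) on `n ≥ 1` vertices has no `(8r-14,8)`-configuration and,
for every `2 ≤ ℓ ≤ 7`, no `(rℓ-2ℓ+1, ℓ)`-configuration, then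
`r(r-1)·|E(G)| ≤ n(n-1)`. -/
theorem upper_bound_G8_free (r n : ℕ) (hr : 4 ≤ r) (hn : 1 ≤ n)
    (G : Finset (Finset (Fin n))) (huniform : ∀ e ∈ G, e.card = r)
    (h8 : ¬ HasConfig G (8 * r - 14) 8)
    (hsmall : ∀ ℓ, 2 ≤ ℓ → ℓ ≤ 7 → ¬ HasConfig G (r * ℓ - 2 * ℓ + 1) ℓ) :
    r * (r - 1) * G.card ≤ n * (n - 1) := by
  obtain ⟨s, rfl⟩ : ∃ s, r = s + 2 := ⟨r - 2, by omega⟩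
  have H : BES.Good s G := by
    refine ⟨by omega, huniform, ?_, ?_⟩
    · intro S hS hne hc
      rcases Nat.lt_or_ge S.card 2 with h | h
      · obtain ⟨e, rfl⟩ := Finset.card_eq_one.1
          (show S.card = 1 by have := Finset.card_pos.2 hne; omega)
        rw [BES.V_single, huniform e (hS (Finset.mem_singleton_self e))]
        simp
      · by_contra hcon
        apply hsmall S.card h hc
        refine ⟨S, hS, rfl, ?_⟩
        have : (s + 2) * S.card - 2 * S.card = s * S.card := by
          rw [add_mul]; omega
        rw [this]
        change (BES.V S).card ≤ _
        omega
    · intro S hS hc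
      by_contra hcon
      apply h8
      refine ⟨S, hS, hc, ?_⟩
      change (BES.V S).card ≤ _
      omega
  have h := H.main
  rw [Fintype.card_fin] at h
  have a1 : ∀ m : ℕ, m.choose 2 * 2 = m * (m - 1) := by
    intro m
    rw [Nat.choose_two_right]
    exact Nat.div_mul_cancel (Nat.even_mul_pred_self m).two_dvd
  calc (s + 2) * (s + 2 - 1) * G.card = G.card * (s + 2).choose 2 * 2 := by
        rw [← a1]; ring
    _ ≤ n.choose 2 * 2 := Nat.mul_le_mul_right 2 h
    _ = n * (n - 1) := a1 n
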